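/- arXiv:2101.03800 — 2 statements merged into one kernel-verified Lean document; each statement's English description precedes it below -/
import Mathlib

section
/- Let T be a tree (a connected acyclic graph) with at least two vertices. A set M of edges of T is a matching cut of T if and only if M is a nonempty matching of T. -/
namespace MatchingCutPaper

/-- The set of edges of `G` with one endpoint in `A` and the other endpoint outside `A`. -/
def cutEdges {V : Type} (G : SimpleGraph V) (A : Set V) : Set (Sym2 V) :=
  {e | e ∈ G.edgeSet ∧ ∃ u v : V, e = s(u, v) ∧ u ∈ A ∧ v ∉ A}

/-- `M` is a matching of `G`: a set of edges of `G`, no two of which share an endpoint. -/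
def IsMatchingSet {V : Type} (G : SimpleGraph V) (M : Set (Sym2 V)) : Prop :=
  M ⊆ G.edgeSet ∧ ∀ e ∈ M, ∀ f ∈ M, e ≠ f → ∀ v : V, ¬(v ∈ e ∧ v ∈ f)

/-- `M` is a matching cut of `G`: a matching of the form `E(A, B)` for a partition `{A, B}`
of the vertex set into two nonempty parts. -/
def IsMatchingCut {V : Type} (G : SimpleGraph V) (M : Set (Sym2 V)) : Prop :=
  IsMatchingSet G M ∧ ∃ A : Set V, A.Nonempty ∧ Aᶜ.Nonempty ∧ M = cutEdges G A

/-- A matching cut is minimal if no proper subset of it is a matching cut. -/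
def IsMinimalMatchingCut {V : Type} (G : SimpleGraph V) (M : Set (Sym2 V)) : Prop :=
  IsMatchingCut G M ∧ ∀ M' : Set (Sym2 V), M' ⊂ M → ¬ IsMatchingCut G M'

/-- A matching cut is maximal if no proper superset of it is a matching cut. -/
def IsMaximalMatchingCut {V : Type} (G : SimpleGraph V) (M : Set (Sym2 V)) : Prop :=
  IsMatchingCut G M ∧ ∀ M' : Set (Sym2 V), M ⊂ M' → ¬ IsMatchingCut G M'

open Classical in
/-- Along an edge of a tree, the number of edges in `M` on the path from a root changes parity
exactly when the edge belongs to `M`. -/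
theorem even_countP_path_iff_of_adj {V : Type} {T : SimpleGraph V} (hacyc : T.IsAcyclic)
    (M : Set (Sym2 V)) {r u v : V} (huv : T.Adj u v) {p : T.Walk r u} {q : T.Walk r v}
    (hp : p.IsPath) (hq : q.IsPath) :
    (Even (p.edges.countP (· ∈ M)) ↔ Even (q.edges.countP (· ∈ M))) ↔ s(u, v) ∉ M := by
  by_cases hv : v ∈ p.support
  · rw [hacyc.path_concat hq hp huv.symm hv, SimpleGraph.Walk.edges_concat]
    by_cases h : s(u, v) ∈ M <;>
      simp [Sym2.eq_swap (a := v), h, List.countP_append, Nat.even_add_one, -Nat.not_even_iff_odd]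
  · have hu := hacyc.mem_support_of_ne_mem_support_of_adj_of_isPath hq hp huv.symm hv
    rw [hacyc.path_concat hp hq huv hu, SimpleGraph.Walk.edges_concat]
    by_cases h : s(u, v) ∈ M <;>
      simp [h, List.countP_append, Nat.even_add_one, -Nat.not_even_iff_odd]

/-- Every set of edges of a tree is an edge cut. -/
theorem exists_eq_cutEdges {V : Type} {T : SimpleGraph V} (hconn : T.Connected)
    (hacyc : T.IsAcyclic) {M : Set (Sym2 V)} (hM : M ⊆ T.edgeSet) :
    ∃ A : Set V, M = cutEdges T A := by
  classical
  obtain ⟨r⟩ := hconn.nonempty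
  choose p hp using fun v => (hconn r v).exists_isPath
  refine ⟨{v | Even ((p v).edges.countP (· ∈ M))}, Set.ext fun e => ⟨fun he => ?_, ?_⟩⟩
  · refine ⟨hM he, ?_⟩
    induction e with
    | _ u v =>
      have h := even_countP_path_iff_of_adj hacyc M (hM he) (hp u) (hp v)
      by_cases hu : Even ((p u).edges.countP (· ∈ M))
      · exact ⟨u, v, rfl, hu, fun hv => h.1 (iff_of_true hu hv) he⟩
      · exact ⟨v, u, Sym2.eq_swap, by_contra fun hv => h.1 (iff_of_false hu hv) he, hu⟩
  · rintro ⟨he, u, v, rfl, hu, hv⟩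
    by_contra h
    exact hv (((even_countP_path_iff_of_adj hacyc M he (hp u) (hp v)).2 h).1 hu)

/-- In a connected graph, the edge cut between two nonempty parts is nonempty. -/
theorem cutEdges_nonempty {V : Type} {G : SimpleGraph V} (hconn : G.Connected) {A : Set V}
    (hA : A.Nonempty) (hAc : Aᶜ.Nonempty) : (cutEdges G A).Nonempty := by
  obtain ⟨a, ha⟩ := hA
  obtain ⟨b, hb⟩ := hAc
  obtain ⟨w⟩ := hconn a b
  obtain ⟨d, -, hd₁, hd₂⟩ := w.exists_boundary_dart A ha hb
  exact ⟨s(d.fst, d.snd), d.adj, d.fst, d.snd, rfl, hd₁, hd₂⟩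

/-- Let `T` be a tree (connected and acyclic) with at least two vertices.  A set `M` of
edges of `T` is a matching cut of `T` if and only if `M` is a nonempty matching of `T`. -/
theorem tree_isMatchingCut_iff {V : Type} [Fintype V] (T : SimpleGraph V)
    (hconn : T.Connected) (hacyc : T.IsAcyclic) (hcard : 2 ≤ Fintype.card V)
    (M : Set (Sym2 V)) :
    IsMatchingCut T M ↔ M.Nonempty ∧ IsMatchingSet T M := by
  constructor
  · rintro ⟨hM, A, hA, hAc, rfl⟩
    exact ⟨cutEdges_nonempty hconn hA hAc, hM⟩
  · rintro ⟨⟨e, he⟩, hM⟩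
    obtain ⟨A, rfl⟩ := exists_eq_cutEdges hconn hacyc hM.1
    obtain ⟨-, u, v, -, hu, hv⟩ := he
    exact ⟨hM, A, ⟨u, hu⟩, ⟨v, hv⟩, rfl⟩

end MatchingCutPaper
end

section
/- Let G be a connected graph and let T be a spanning tree of G (a connected acyclic spanning subgraph of G). Then the number of matching cuts of G is at most the number of matching cuts of T. -/
namespace MatchingCutPaper

theorem mk_mem_cutEdges_iff {V : Type} {G : SimpleGraph V} {A : Set V} {u v : V} :
    s(u, v) ∈ cutEdges G A ↔ G.Adj u v ∧ ¬(u ∈ A ↔ v ∈ A) := by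
  constructor
  · rintro ⟨he, x, y, hxy, hx, hy⟩
    refine ⟨he, ?_⟩
    rcases Sym2.eq_iff.mp hxy with ⟨rfl, rfl⟩ | ⟨rfl, rfl⟩ <;> tauto
  · rintro ⟨hadj, huv⟩
    by_cases hu : u ∈ A
    · exact ⟨hadj, u, v, rfl, hu, by tauto⟩
    · exact ⟨hadj, v, u, Sym2.eq_swap, by tauto, hu⟩

theorem cutEdges_inter_edgeSet {V : Type} {G T : SimpleGraph V} (hle : T ≤ G) (A : Set V) :
    cutEdges G A ∩ T.edgeSet = cutEdges T A := by
  ext e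
  exact ⟨fun ⟨h, hT⟩ => ⟨hT, h.2⟩,
    fun h => ⟨⟨SimpleGraph.edgeSet_mono hle h.1, h.2⟩, h.1⟩⟩

theorem IsMatchingCut.inter_edgeSet {V : Type} {G T : SimpleGraph V} (hle : T ≤ G)
    {M : Set (Sym2 V)} (hM : IsMatchingCut G M) : IsMatchingCut T (M ∩ T.edgeSet) := by
  obtain ⟨⟨-, hmatch⟩, A, hA, hAc, rfl⟩ := hM
  exact ⟨⟨Set.inter_subset_right, fun e he f hf => hmatch e he.1 f hf.1⟩,
    A, hA, hAc, cutEdges_inter_edgeSet hle A⟩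

/-- Two vertex sets with the same cut in a connected graph are equal or complementary. -/
theorem mem_iff_mem_iff_of_cutEdges_eq {V : Type} {T : SimpleGraph V} (hT : T.Connected)
    {A B : Set V} (h : cutEdges T A = cutEdges T B) (u v : V) :
    (u ∈ A ↔ v ∈ A) ↔ (u ∈ B ↔ v ∈ B) := by
  obtain ⟨p⟩ := hT.preconnected u v
  induction p with
  | nil => tauto
  | @cons u w v huw _ ih =>
    have key : s(u, w) ∈ cutEdges T A ↔ s(u, w) ∈ cutEdges T B := by rw [h]
    rw [mk_mem_cutEdges_iff, mk_mem_cutEdges_iff] at key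
    tauto

/-- A cut of a graph is determined by its edges in a connected spanning subgraph. -/
theorem cutEdges_eq_of_subgraph {V : Type} {G T : SimpleGraph V} (hT : T.Connected)
    {A B : Set V} (h : cutEdges T A = cutEdges T B) : cutEdges G A = cutEdges G B := by
  ext e
  induction e using Sym2.ind with
  | _ u v =>
    rw [mk_mem_cutEdges_iff, mk_mem_cutEdges_iff, mem_iff_mem_iff_of_cutEdges_eq hT h]

/-- Let `G` be a connected graph and `T` a spanning tree of `G` (a connected acyclic
spanning subgraph of `G`).  Then the number of matching cuts of `G` is at most the number
of matching cuts of `T`. -/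
theorem card_matchingCuts_le_spanningTree {V : Type} [Fintype V] (G T : SimpleGraph V)
    (hG : G.Connected) (hle : T ≤ G) (hTconn : T.Connected) (hTacyc : T.IsAcyclic) :
    Nat.card {M : Set (Sym2 V) // IsMatchingCut G M} ≤
      Nat.card {M : Set (Sym2 V) // IsMatchingCut T M} := by
  refine Nat.card_le_card_of_injective
    (fun M => ⟨M.1 ∩ T.edgeSet, M.2.inter_edgeSet hle⟩) ?_
  rintro ⟨_, _, A, _, _, rfl⟩ ⟨_, _, B, _, _, rfl⟩ hAB
  have h : cutEdges G A ∩ T.edgeSet = cutEdges G B ∩ T.edgeSet := congrArg Subtype.val hAB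
  rw [cutEdges_inter_edgeSet hle, cutEdges_inter_edgeSet hle] at h
  exact Subtype.ext (cutEdges_eq_of_subgraph hTconn h)

end MatchingCutPaper
end
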